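/- arXiv:2012.11155 — 6 statements merged into one kernel-verified Lean document; each statement's English description precedes it below -/
import Mathlib

section
/- Let a < b be real numbers, let z : [0,1] → ℝ be Lebesgue integrable with z(τ) > 0 for almost every τ ∈ [0,1] and ∫₀¹ z(σ) dσ = b − a, and let ρ(τ) := a + ∫₀^τ z(σ) dσ. Let g : [a,b] → ℝ^d be Lebesgue integrable, let X_a ∈ ℝ^d, and define X(t) := X_a + ∫_a^t g(s) ds for t ∈ [a,b]. Then the function σ ↦ z(σ)·g(ρ(σ)) is Lebesgue integrable on [0,1], and for every τ ∈ [0,1] one has X(ρ(τ)) = X_a + ∫₀^τ z(σ)·g(ρ(σ)) dσ. -/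
open MeasureTheory Set

/-- The primitive of an a.e. nonnegative integrable function is monotone. -/
theorem monotoneOn_integral_of_ae_nonneg {l u : ℝ} {z : ℝ → ℝ}
    (hz : IntegrableOn z (Icc l u)) (hz0 : ∀ᵐ x ∂(volume.restrict (Icc l u)), 0 ≤ z x) :
    MonotoneOn (fun x => ∫ s in l..x, z s) (Icc l u) := by
  intro x hx y hy hxy
  have hsub : ∀ w ∈ Icc l u, IntervalIntegrable z volume l w := fun w hw =>
    (intervalIntegrable_iff_integrableOn_Icc_of_le hw.1).2
      (hz.mono_set (Icc_subset_Icc_right hw.2))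
  have hadd := intervalIntegral.integral_interval_sub_left (hsub y hy) (hsub x hx)
  have hnonneg : 0 ≤ ∫ s in x..y, z s :=
    intervalIntegral.integral_nonneg_of_ae_restrict hxy
      (ae_restrict_of_ae_restrict_of_subset (Icc_subset_Icc hx.1 hy.2) hz0)
  dsimp only
  linarith

/-- The primitive `r` of an a.e. nonnegative integrable function `z` pushes the measure with
density `z` forward to Lebesgue measure. -/
theorem map_withDensity_primitive {l u : ℝ} (hlu : l ≤ u) {z r : ℝ → ℝ}
    (hz : IntegrableOn z (Icc l u)) (hz0 : ∀ᵐ x ∂(volume.restrict (Icc l u)), 0 ≤ z x)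
    (hr : ∀ x, r x = r l + ∫ s in l..x, z s) :
    AEMeasurable r ((volume.restrict (Icc l u)).withDensity fun x => ENNReal.ofReal (z x)) ∧
    ((volume.restrict (Icc l u)).withDensity fun x => ENNReal.ofReal (z x)).map r =
      volume.restrict (Icc (r l) (r u)) := by
  have hcont : ContinuousOn r (Icc l u) := by
    have h := intervalIntegral.continuousOn_primitive_interval (a := l) (b := u) (μ := volume)
      (f := z) (by rwa [uIcc_of_le hlu])
    rw [uIcc_of_le hlu] at h
    exact (continuousOn_const.add h).congr fun x _ => hr x
  have hmono : MonotoneOn r (Icc l u) := by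
    intro x hx y hy hxy
    rw [hr x, hr y]
    exact add_le_add_right (monotoneOn_integral_of_ae_nonneg hz hz0 hx hy hxy) _
  have hmeas : AEMeasurable r
      ((volume.restrict (Icc l u)).withDensity fun x => ENNReal.ofReal (z x)) :=
    (hcont.aemeasurable measurableSet_Icc).mono_ac (withDensity_absolutelyContinuous _ _)
  refine ⟨hmeas, ?_⟩
  have hfin : IsFiniteMeasure
      ((volume.restrict (Icc l u)).withDensity fun x => ENNReal.ofReal (z x)) :=
    isFiniteMeasure_withDensity_ofReal hz.2
  have hlu' : r l ≤ r u := hmono (left_mem_Icc.2 hlu) (right_mem_Icc.2 hlu) hlu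
  refine Measure.ext_of_Iic _ _ fun t => ?_
  rw [Measure.map_apply_of_aemeasurable hmeas measurableSet_Iic,
    Measure.restrict_apply measurableSet_Iic, withDensity_apply' _ (r ⁻¹' Iic t),
    Measure.restrict_restrict' measurableSet_Icc]
  rcases lt_or_ge t (r l) with ht | ht
  · have hleft : r ⁻¹' Iic t ∩ Icc l u = ∅ := by
      refine eq_empty_of_forall_notMem fun x hx => ?_
      have h := hmono (left_mem_Icc.2 hlu) hx.2 hx.2.1
      exact absurd (h.trans hx.1) (not_le.2 ht)
    have hright : Iic t ∩ Icc (r l) (r u) = ∅ :=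
      eq_empty_of_forall_notMem fun x hx => absurd (hx.2.1.trans hx.1) (not_le.2 ht)
    simp [hleft, hright]
  · have hcompact : IsCompact (r ⁻¹' Iic t ∩ Icc l u) := by
      rw [inter_comm]
      exact isCompact_Icc.of_isClosed_subset
        (hcont.preimage_isClosed_of_isClosed isClosed_Icc isClosed_Iic) inter_subset_left
    obtain ⟨m, ⟨hmt, hm⟩, hmax⟩ := hcompact.exists_isGreatest ⟨l, ht, left_mem_Icc.2 hlu⟩
    have hrm : r m = min t (r u) := by
      refine le_antisymm (le_min hmt (hmono hm (right_mem_Icc.2 hlu) hm.2)) ?_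
      obtain ⟨c, hc, hct⟩ := intermediate_value_Icc hlu hcont
        (show min t (r u) ∈ Icc (r l) (r u) from ⟨le_min ht hlu', min_le_right _ _⟩)
      rw [← hct]
      exact hmono hc hm (hmax ⟨hct.le.trans (min_le_left _ _), hc⟩)
    have hleft : r ⁻¹' Iic t ∩ Icc l u = Icc l m := by
      ext x
      exact ⟨fun hx => ⟨hx.2.1, hmax hx⟩, fun hx =>
        ⟨(hmono ⟨hx.1, hx.2.trans hm.2⟩ hm hx.2).trans hmt, hx.1, hx.2.trans hm.2⟩⟩
    have hright : Iic t ∩ Icc (r l) (r u) = Icc (r l) (r m) := by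
      ext x
      simp only [hrm, mem_inter_iff, mem_Iic, mem_Icc, le_min_iff]
      tauto
    have hsub : Icc l m ⊆ Icc l u := Icc_subset_Icc_right hm.2
    rw [hleft, hright, Real.volume_Icc, ← ofReal_integral_eq_lintegral_ofReal (hz.mono_set hsub)
      (ae_restrict_of_ae_restrict_of_subset hsub hz0), hr m,
      intervalIntegral.integral_of_le hm.1, integral_Icc_eq_integral_Ioc, add_sub_cancel_left]

/-- Change of variables along the primitive `r` of an a.e. nonnegative integrable function. -/
theorem integrableOn_and_integral_smul_comp_primitive {E : Type*} [NormedAddCommGroup E]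
    [NormedSpace ℝ E] {l u : ℝ} (hlu : l ≤ u) {z r : ℝ → ℝ}
    (hz : IntegrableOn z (Icc l u)) (hz0 : ∀ᵐ x ∂(volume.restrict (Icc l u)), 0 ≤ z x)
    (hr : ∀ x, r x = r l + ∫ s in l..x, z s) {g : ℝ → E}
    (hg : IntegrableOn g (Icc (r l) (r u))) :
    IntegrableOn (fun x => z x • g (r x)) (Icc l u) ∧
      ∫ x in Icc l u, z x • g (r x) = ∫ y in Icc (r l) (r u), g y := by
  obtain ⟨hmeas, hmap⟩ := map_withDensity_primitive hlu hz hz0 hr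
  have hzm : AEMeasurable (fun x => (z x).toNNReal) (volume.restrict (Icc l u)) :=
    hz.aemeasurable.real_toNNReal
  have hcongr : (fun x => (z x).toNNReal • g (r x)) =ᵐ[volume.restrict (Icc l u)]
      fun x => z x • g (r x) := by
    filter_upwards [hz0] with x hx
    rw [NNReal.smul_def, Real.coe_toNNReal _ hx]
  rw [IntegrableOn, ← hmap] at hg
  constructor
  · exact ((integrable_withDensity_iff_integrable_smul₀ hzm).1
      (hg.comp_aemeasurable hmeas)).congr hcongr
  · rw [← hmap, integral_map hmeas hg.1, ← integral_congr_ae hcongr]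
    exact (integral_withDensity_eq_integral_smul₀ hzm fun x => g (r x)).symm

/-- Change of variables along the time reparametrization `ρ(τ) = a + ∫₀^τ z`: if
`X(t) = X_a + ∫_a^t g(s) ds` with `g` integrable on `[a,b]`, then `σ ↦ z(σ) • g(ρ(σ))` is
integrable on `[0,1]` and `X(ρ(τ)) = X_a + ∫₀^τ z(σ) • g(ρ(σ)) dσ` for every `τ ∈ [0,1]`. -/
theorem time_scaling_change_of_variables {d : ℕ} (a b : ℝ) (hab : a < b) (z : ℝ → ℝ)
    (hz_int : IntegrableOn z (Set.Icc (0 : ℝ) 1))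
    (hz_pos : ∀ᵐ τ ∂(volume.restrict (Set.Icc (0 : ℝ) 1)), 0 < z τ)
    (hz_sum : (∫ σ in (0 : ℝ)..1, z σ) = b - a)
    (ρ : ℝ → ℝ) (hρ : ∀ τ, ρ τ = a + ∫ σ in (0 : ℝ)..τ, z σ)
    (g : ℝ → Fin d → ℝ) (hg : IntegrableOn g (Set.Icc a b))
    (Xa : Fin d → ℝ) (X : ℝ → Fin d → ℝ)
    (hX : ∀ t, X t = Xa + ∫ s in a..t, g s) :
    IntegrableOn (fun σ => z σ • g (ρ σ)) (Set.Icc (0 : ℝ) 1) ∧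
    (∀ τ ∈ Set.Icc (0 : ℝ) 1,
        X (ρ τ) = Xa + ∫ σ in (0 : ℝ)..τ, z σ • g (ρ σ)) := by
  have hz0 : ∀ᵐ τ ∂(volume.restrict (Icc (0 : ℝ) 1)), 0 ≤ z τ := hz_pos.mono fun _ h => h.le
  have hρ0 : ρ 0 = a := by simp [hρ]
  have hρ1 : ρ 1 = b := by rw [hρ, hz_sum]; ring
  have hr : ∀ x, ρ x = ρ 0 + ∫ s in (0 : ℝ)..x, z s := fun x => by rw [hρ0, hρ]
  have hmono : MonotoneOn ρ (Icc 0 1) := by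
    intro x hx y hy hxy
    rw [hρ x, hρ y]
    exact add_le_add_right (monotoneOn_integral_of_ae_nonneg hz_int hz0 hx hy hxy) _
  refine ⟨(integrableOn_and_integral_smul_comp_primitive zero_le_one hz_int hz0 hr
    (by rwa [hρ0, hρ1])).1, fun τ hτ => ?_⟩
  have hsub : Icc 0 τ ⊆ Icc (0 : ℝ) 1 := Icc_subset_Icc_right hτ.2
  have haτ : a ≤ ρ τ := hρ0 ▸ hmono (left_mem_Icc.2 zero_le_one) hτ hτ.1
  have hτb : ρ τ ≤ b := hρ1 ▸ hmono hτ (right_mem_Icc.2 zero_le_one) hτ.2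
  have h := (integrableOn_and_integral_smul_comp_primitive hτ.1 (hz_int.mono_set hsub)
    (ae_restrict_of_ae_restrict_of_subset hsub hz0) hr
    (hg.mono_set (Icc_subset_Icc hρ0.ge hτb))).2
  rw [hX, intervalIntegral.integral_of_le haτ, intervalIntegral.integral_of_le hτ.1,
    ← integral_Icc_eq_integral_Ioc, ← integral_Icc_eq_integral_Ioc, h, hρ0]
end

section
/- Let a < b be real numbers, let c > 0, and let z : [0,1] → ℝ be Lebesgue integrable with z(τ) ≥ c for almost every τ ∈ [0,1] and ∫₀¹ z(σ) dσ = b − a, and let ρ(τ) := a + ∫₀^τ z(σ) dσ. Then ρ is a strictly increasing bijection of [0,1] onto [a,b], its inverse ρ⁻¹ : [a,b] → [0,1] is Lipschitz with Lipschitz constant 1/c, and for almost every t ∈ (a,b) the inverse ρ⁻¹ is differentiable at t with derivative (ρ⁻¹)'(t) = 1/z(ρ⁻¹(t)). -/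
open MeasureTheory Set

/-- If `f` is a strictly increasing bijection of `[p, q]` onto `[f p, f q]` whose increments from
`p` are the integrals of a nonnegative function `z`, then its inverse `g` transports Lebesgue
measure on `[f p, f q]` to the measure with density `z` on `[p, q]`. -/
theorem map_restrict_Icc_eq_withDensity_of_invOn {p q : ℝ} (hpq : p ≤ q) {f g z : ℝ → ℝ}
    (hz : IntegrableOn z (Icc p q)) (hz0 : 0 ≤ᵐ[volume.restrict (Icc p q)] z)
    (hf : StrictMonoOn f (Icc p q)) (hfz : ∀ x ∈ Icc p q, f x - f p = ∫ t in p..x, z t)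
    (hinv : RightInvOn g f (Icc (f p) (f q))) (hg : MapsTo g (Icc (f p) (f q)) (Icc p q))
    (hgm : AEMeasurable g (volume.restrict (Icc (f p) (f q)))) :
    (volume.restrict (Icc (f p) (f q))).map g =
      (volume.restrict (Icc p q)).withDensity fun x => ENNReal.ofReal (z x) := by
  refine Measure.ext_of_Iic _ _ fun x => ?_
  rw [Measure.map_apply_of_aemeasurable hgm measurableSet_Iic,
    withDensity_apply _ measurableSet_Iic, Measure.restrict_restrict measurableSet_Iic,
    Measure.restrict_apply' measurableSet_Icc]
  rcases lt_or_ge x p with hx | hx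
  · have h1 : g ⁻¹' Iic x ∩ Icc (f p) (f q) = ∅ := by
      ext t
      simp only [mem_inter_iff, mem_preimage, mem_Iic, mem_empty_iff_false, iff_false, not_and]
      intro h ht
      linarith [(hg ht).1]
    have h2 : Iic x ∩ Icc p q = ∅ := by
      ext t
      simp only [mem_inter_iff, mem_Iic, mem_Icc, mem_empty_iff_false, iff_false]
      rintro ⟨h, h', -⟩
      linarith
    simp [h1, h2]
  · have hm : min x q ∈ Icc p q := ⟨le_min hx hpq, min_le_right _ _⟩
    have h1 : g ⁻¹' Iic x ∩ Icc (f p) (f q) = Icc (f p) (f (min x q)) := by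
      ext t
      simp only [mem_inter_iff, mem_preimage, mem_Iic]
      constructor
      · rintro ⟨h, ht⟩
        refine ⟨ht.1, ?_⟩
        rw [← hinv ht]
        exact (hf.le_iff_le (hg ht) hm).2 (le_min h (hg ht).2)
      · intro h
        have ht : t ∈ Icc (f p) (f q) :=
          ⟨h.1, h.2.trans (hf.monotoneOn hm (right_mem_Icc.2 hpq) hm.2)⟩
        have h' := h.2
        rw [← hinv ht] at h'
        exact ⟨((hf.le_iff_le (hg ht) hm).1 h').trans (min_le_left _ _), ht⟩
    have h2 : Iic x ∩ Icc p q = Icc p (min x q) := by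
      ext t
      simp only [mem_inter_iff, mem_Iic, mem_Icc, le_min_iff]
      tauto
    have hsub : Icc p (min x q) ⊆ Icc p q := Icc_subset_Icc_right hm.2
    rw [h1, h2, Real.volume_Icc, hfz _ hm, intervalIntegral.integral_of_le hm.1,
      ← integral_Icc_eq_integral_Ioc]
    exact ofReal_integral_eq_lintegral_ofReal (hz.mono_set hsub)
      (ae_restrict_of_ae_restrict_of_subset hsub hz0)

/-- If `z ≥ c > 0` a.e. on `[0,1]` and `∫₀¹ z = b − a`, then `ρ(τ) = a + ∫₀^τ z` is a strictly
increasing bijection of `[0,1]` onto `[a,b]`, its inverse is `1/c`-Lipschitz on `[a,b]`, and for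
a.e. `t ∈ (a,b)` the inverse is differentiable at `t` with derivative `1 / z(ρ⁻¹(t))`. -/
theorem time_scaling_inverse_properties (a b c : ℝ) (hab : a < b) (hc : 0 < c)
    (z : ℝ → ℝ)
    (hz_int : IntegrableOn z (Set.Icc (0 : ℝ) 1))
    (hz_ge : ∀ᵐ τ ∂(volume.restrict (Set.Icc (0 : ℝ) 1)), c ≤ z τ)
    (hz_sum : (∫ σ in (0 : ℝ)..1, z σ) = b - a)
    (ρ : ℝ → ℝ) (hρ : ∀ τ, ρ τ = a + ∫ σ in (0 : ℝ)..τ, z σ) :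
    StrictMonoOn ρ (Set.Icc (0 : ℝ) 1) ∧
    Set.BijOn ρ (Set.Icc (0 : ℝ) 1) (Set.Icc a b) ∧
    (∃ ρinv : ℝ → ℝ,
      Set.InvOn ρinv ρ (Set.Icc (0 : ℝ) 1) (Set.Icc a b) ∧
      Set.MapsTo ρinv (Set.Icc a b) (Set.Icc (0 : ℝ) 1) ∧
      LipschitzOnWith (Real.toNNReal (1 / c)) ρinv (Set.Icc a b) ∧
      (∀ᵐ t ∂(volume.restrict (Set.Ioo a b)),
        HasDerivAt ρinv (1 / z (ρinv t)) t)) := by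
  have hint : ∀ x ∈ Icc (0 : ℝ) 1, ∀ y ∈ Icc (0 : ℝ) 1, IntervalIntegrable z volume x y :=
    fun x hx y hy => (hz_int.mono_set (uIcc_subset_Icc hx hy)).intervalIntegrable
  have h0 : (0 : ℝ) ∈ Icc (0 : ℝ) 1 := by simp
  have h1 : (1 : ℝ) ∈ Icc (0 : ℝ) 1 := by simp
  have hρ0 : ρ 0 = a := by simp [hρ]
  have hρ1 : ρ 1 = b := by rw [hρ, hz_sum]; ring
  have hlower : ∀ x ∈ Icc (0 : ℝ) 1, ∀ y ∈ Icc (0 : ℝ) 1, x ≤ y → c * (y - x) ≤ ρ y - ρ x := by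
    intro x hx y hy hxy
    have hsub : ρ y - ρ x = ∫ σ in x..y, z σ := by
      rw [hρ, hρ, add_sub_add_left_eq_sub,
        intervalIntegral.integral_interval_sub_left (hint 0 h0 y hy) (hint 0 h0 x hx)]
    have hmono : ∫ _ in x..y, c ≤ ∫ σ in x..y, z σ :=
      intervalIntegral.integral_mono_ae_restrict hxy intervalIntegrable_const (hint x hx y hy)
        (ae_restrict_of_ae_restrict_of_subset (Icc_subset_Icc hx.1 hy.2) hz_ge)
    rw [intervalIntegral.integral_const, smul_eq_mul] at hmono
    rw [hsub]
    linarith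
  have hstrict : StrictMonoOn ρ (Icc 0 1) := by
    intro x hx y hy hxy
    have := hlower x hx y hy hxy.le
    have := mul_pos hc (sub_pos.2 hxy)
    linarith
  have hcont : ContinuousOn ρ (Icc 0 1) := by
    rw [show ρ = fun τ => a + ∫ σ in (0 : ℝ)..τ, z σ from funext hρ]
    have := intervalIntegral.continuousOn_primitive_interval' (hint 0 h0 1 h1) left_mem_uIcc
    rw [uIcc_of_le zero_le_one] at this
    exact continuousOn_const.add this
  have hbij : BijOn ρ (Icc 0 1) (Icc a b) := by
    refine ⟨fun x hx => ⟨?_, ?_⟩, hstrict.injOn, ?_⟩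
    · exact hρ0 ▸ hstrict.monotoneOn h0 hx hx.1
    · exact hρ1 ▸ hstrict.monotoneOn hx h1 hx.2
    · have := intermediate_value_Icc zero_le_one hcont
      rwa [hρ0, hρ1] at this
  obtain ⟨g, hinv, hg⟩ : ∃ g, InvOn g ρ (Icc 0 1) (Icc a b) ∧ MapsTo g (Icc a b) (Icc 0 1) :=
    ⟨_, hbij.invOn_invFunOn, hbij.surjOn.mapsTo_invFunOn⟩
  have hexpand : ∀ x ∈ Icc (0 : ℝ) 1, ∀ y ∈ Icc (0 : ℝ) 1, c * |x - y| ≤ |ρ x - ρ y| := by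
    intro x hx y hy
    rcases le_total x y with h | h
    · rw [abs_sub_comm x y, abs_sub_comm (ρ x), abs_of_nonneg (sub_nonneg.2 h)]
      exact (hlower x hx y hy h).trans (le_abs_self _)
    · rw [abs_of_nonneg (sub_nonneg.2 h)]
      exact (hlower y hy x hx h).trans (le_abs_self _)
  have hlip : LipschitzOnWith (Real.toNNReal (1 / c)) g (Icc a b) := by
    refine LipschitzOnWith.of_dist_le_mul fun s hs t ht => ?_
    have := hexpand _ (hg hs) _ (hg ht)
    rw [hinv.2 hs, hinv.2 ht] at this
    rw [Real.coe_toNNReal _ (by positivity), Real.dist_eq, Real.dist_eq, one_div_mul_eq_div,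
      le_div_iff₀ hc, mul_comm]
    exact this
  refine ⟨hstrict, hbij, g, hinv, hg, hlip, ?_⟩
  have hmap : (volume.restrict (Icc a b)).map g =
      (volume.restrict (Icc 0 1)).withDensity fun x => ENNReal.ofReal (z x) := by
    have := map_restrict_Icc_eq_withDensity_of_invOn (f := ρ) (g := g) zero_le_one hz_int
      (hz_ge.mono fun x hx => hc.le.trans hx) hstrict (fun x _ => by rw [hρ0, hρ]; ring)
    rw [hρ0, hρ1] at this
    exact this hinv.2 hg (hlip.continuousOn.aemeasurable measurableSet_Icc)
  have hderiv : ∀ᵐ τ ∂(volume.restrict (Icc (0 : ℝ) 1)), HasDerivAt ρ (z τ) τ ∧ c ≤ z τ := by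
    have hd := (hint 0 h0 1 h1).ae_hasDerivAt_integral
    rw [uIcc_of_le zero_le_one] at hd
    filter_upwards [ae_restrict_of_ae hd, hz_ge, ae_restrict_mem measurableSet_Icc] with τ h h' hτ
    refine ⟨?_, h'⟩
    rw [show ρ = fun τ => a + ∫ σ in (0 : ℝ)..τ, z σ from funext hρ]
    exact (h hτ 0 h0).const_add a
  have hpull : ∀ᵐ t ∂(volume.restrict (Icc a b)),
      HasDerivAt ρ (z (g t)) (g t) ∧ c ≤ z (g t) := by
    refine ae_of_ae_map (p := fun τ => HasDerivAt ρ (z τ) τ ∧ c ≤ z τ)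
      (hlip.continuousOn.aemeasurable measurableSet_Icc) ?_
    rw [hmap]
    exact (withDensity_absolutelyContinuous _ _).ae_le hderiv
  filter_upwards [ae_restrict_of_ae_restrict_of_subset Ioo_subset_Icc_self hpull,
    ae_restrict_mem measurableSet_Ioo] with t ht htm
  have hnhds := Icc_mem_nhds htm.1 htm.2
  rw [one_div]
  exact ht.1.of_local_left_inverse (hlip.continuousOn.continuousAt hnhds)
    (hc.trans_le ht.2).ne' (Filter.eventually_of_mem hnhds fun y hy => hinv.2 hy)
end

section
/- Let a < b be real numbers, let z : [0,1] → ℝ be Lebesgue integrable with z(τ) > 0 for almost every τ ∈ [0,1] and ∫₀¹ z(σ) dσ = b − a, and let ρ(τ) := a + ∫₀^τ z(σ) dσ. Then for every Lebesgue measurable function u : [a,b] → ℝ^r, one has ∫_a^b 1_{{t : u(t) ≠ 0}}(t) dt = ∫₀¹ 1_{{τ : u(ρ(τ)) ≠ 0}}(τ) · z(τ) dτ. -/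
open MeasureTheory Set

/-- A primitive of an integrable, almost everywhere positive function pushes the measure with that
density forward to Lebesgue measure. -/
theorem map_primitive_withDensity {a b : ℝ} {z ρ : ℝ → ℝ}
    (hz_int : IntegrableOn z (Icc (0 : ℝ) 1))
    (hz_pos : ∀ᵐ τ ∂(volume.restrict (Icc (0 : ℝ) 1)), 0 < z τ)
    (hz_sum : (∫ σ in (0 : ℝ)..1, z σ) = b - a)
    (hρ : ∀ τ, ρ τ = a + ∫ σ in (0 : ℝ)..τ, z σ)
    (hρ_meas : AEMeasurable ρ (volume.restrict (Ioc (0 : ℝ) 1)))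
    (hρ_cont : ContinuousOn ρ (Icc 0 1)) :
    ((volume.restrict (Ioc (0 : ℝ) 1)).withDensity fun τ ↦ ENNReal.ofReal (z τ)).map ρ =
      volume.restrict (Ioc a b) := by
  have hint : ∀ x ∈ Icc (0 : ℝ) 1, ∀ y ∈ Icc (0 : ℝ) 1, IntervalIntegrable z volume x y :=
    fun x hx y hy ↦ (hz_int.mono_set (uIcc_subset_Icc hx hy)).intervalIntegrable
  have hmono : StrictMonoOn ρ (Icc 0 1) := by
    intro x hx y hy hxy
    have hpos : 0 < ∫ σ in x..y, z σ := by
      have hsub : Ioc x y ⊆ Icc 0 1 := fun w hw ↦ ⟨hx.1.trans hw.1.le, hw.2.trans hy.2⟩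
      have hp := ae_restrict_of_ae_restrict_of_subset hsub hz_pos
      rw [intervalIntegral.integral_pos_iff_support_of_nonneg_ae'
        (by rw [uIoc_of_le hxy.le]; exact hp.mono fun _ h ↦ h.le) (hint x hx y hy)]
      refine ⟨hxy, ?_⟩
      have : volume (Ioc x y) ≤ volume (Function.support z ∩ Ioc x y) := by
        refine measure_mono_ae ?_
        filter_upwards [(ae_restrict_iff' measurableSet_Ioc).1 hp] with w hw hw'
        exact ⟨(hw hw').ne', hw'⟩
      refine lt_of_lt_of_le ?_ this
      simpa using hxy
    have := intervalIntegral.integral_add_adjacent_intervals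
      (hint 0 (by simp) x hx) (hint x hx y hy)
    rw [hρ, hρ]
    linarith
  have h0 : ρ 0 = a := by simp [hρ]
  have h1 : ρ 1 = b := by rw [hρ, hz_sum]; ring
  have hab : a ≤ b := by
    rw [← h0, ← h1]
    exact hmono.monotoneOn (by simp) (by simp) zero_le_one
  have hzI : IntegrableOn z (Ioc 0 1) := hz_int.mono_set Ioc_subset_Icc_self
  have hfin : IsFiniteMeasure
      ((volume.restrict (Ioc (0 : ℝ) 1)).withDensity fun τ ↦ ENNReal.ofReal (z τ)) :=
    isFiniteMeasure_withDensity_ofReal hzI.2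
  refine Measure.ext_of_Iic _ _ fun t ↦ ?_
  rw [Measure.map_apply_of_aemeasurable
    (hρ_meas.mono_ac (withDensity_absolutelyContinuous _ _)) measurableSet_Iic]
  obtain ⟨s, hs, hst⟩ : max a (min b t) ∈ ρ '' Icc 0 1 := by
    refine intermediate_value_Icc zero_le_one hρ_cont ?_
    rw [h0, h1]
    exact ⟨le_max_left _ _, max_le hab (min_le_left _ _)⟩
  have hset : ∀ τ ∈ Ioc (0 : ℝ) 1, ρ τ ≤ t ↔ τ ≤ s := by
    intro τ hτ
    have hτ' := Ioc_subset_Icc_self hτ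
    have ha : a < ρ τ := h0 ▸ hmono (by simp) hτ' hτ.1
    have hb : ρ τ ≤ b := h1 ▸ hmono.monotoneOn hτ' (by simp) hτ.2
    rw [← hmono.le_iff_le hτ' hs, hst, le_max_iff, le_min_iff]
    exact ⟨fun h ↦ Or.inr ⟨hb, h⟩, fun h ↦ h.elim (fun h ↦ absurd h ha.not_ge) And.right⟩
  have hsub : Ioc 0 s ⊆ Icc 0 1 := fun w hw ↦ ⟨hw.1.le, hw.2.trans hs.2⟩
  calc _ = ((volume.restrict (Ioc (0 : ℝ) 1)).withDensity
          fun τ ↦ ENNReal.ofReal (z τ)) (Iic s) := by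
        refine measure_congr ((withDensity_absolutelyContinuous _ _).ae_le ?_)
        filter_upwards [ae_restrict_mem measurableSet_Ioc] with τ hτ
        exact propext (hset τ hτ)
    _ = ∫⁻ τ in Ioc 0 s, ENNReal.ofReal (z τ) := by
        rw [withDensity_apply _ measurableSet_Iic, Measure.restrict_restrict measurableSet_Iic,
          inter_comm, Ioc_inter_Iic, inf_eq_right.2 hs.2]
    _ = ENNReal.ofReal (∫ τ in Ioc 0 s, z τ) :=
        (ofReal_integral_eq_lintegral_ofReal (hz_int.mono_set hsub)
          ((ae_restrict_of_ae_restrict_of_subset hsub hz_pos).mono fun _ h ↦ h.le)).symm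
    _ = ENNReal.ofReal (max a (min b t) - a) := by
        rw [← intervalIntegral.integral_of_le hs.1, ← hst, hρ]
        ring_nf
    _ = _ := by
        rw [Measure.restrict_apply measurableSet_Iic, inter_comm, Ioc_inter_Iic, Real.volume_Ioc]
        rcases le_total a (min b t) with h | h
        · rw [max_eq_right h]
        · rw [max_eq_left h, sub_self, ENNReal.ofReal_zero,
            ENNReal.ofReal_of_nonpos (sub_nonpos.2 h)]

/-- The sparsity (L⁰) cost of a control is invariant under the time reparametrization
`ρ(τ) = a + ∫₀^τ z`: for every measurable `u`,
`∫_a^b 1_{{u ≠ 0}}(t) dt = ∫₀¹ 1_{{u∘ρ ≠ 0}}(τ) z(τ) dτ`. -/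
theorem sparsity_cost_invariant {r : ℕ} (a b : ℝ) (hab : a < b) (z : ℝ → ℝ)
    (hz_int : IntegrableOn z (Set.Icc (0 : ℝ) 1))
    (hz_pos : ∀ᵐ τ ∂(volume.restrict (Set.Icc (0 : ℝ) 1)), 0 < z τ)
    (hz_sum : (∫ σ in (0 : ℝ)..1, z σ) = b - a)
    (ρ : ℝ → ℝ) (hρ : ∀ τ, ρ τ = a + ∫ σ in (0 : ℝ)..τ, z σ)
    (u : ℝ → Fin r → ℝ) (hu : Measurable u) :
    (∫ t in a..b, (if u t ≠ 0 then (1 : ℝ) else 0)) =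
      ∫ τ in (0 : ℝ)..1, (if u (ρ τ) ≠ 0 then (1 : ℝ) else 0) * z τ := by
  have hρ_cont : ContinuousOn ρ (Icc 0 1) := by
    rw [funext hρ]
    refine continuousOn_const.add ?_
    have h := intervalIntegral.continuousOn_primitive_interval
      (μ := volume) (f := z) (a := 0) (b := 1) (by rwa [uIcc_of_le zero_le_one])
    rwa [uIcc_of_le zero_le_one] at h
  have hρ_meas : AEMeasurable ρ (volume.restrict (Ioc (0 : ℝ) 1)) :=
    (hρ_cont.mono Ioc_subset_Icc_self).aemeasurable measurableSet_Ioc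
  have hzI : IntegrableOn z (Ioc 0 1) := hz_int.mono_set Ioc_subset_Icc_self
  have hf : Measurable fun t ↦ if u t ≠ 0 then (1 : ℝ) else 0 :=
    Measurable.ite (hu (measurableSet_singleton 0).compl) measurable_const measurable_const
  rw [intervalIntegral.integral_of_le hab.le, intervalIntegral.integral_of_le zero_le_one,
    ← map_primitive_withDensity hz_int hz_pos hz_sum hρ hρ_meas hρ_cont,
    integral_map (hρ_meas.mono_ac (withDensity_absolutelyContinuous _ _))
      hf.aestronglyMeasurable,
    integral_withDensity_eq_integral_toReal_smul₀ hzI.1.aemeasurable.ennreal_ofReal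
      (Filter.Eventually.of_forall fun _ ↦ ENNReal.ofReal_lt_top)]
  refine integral_congr_ae ?_
  filter_upwards [ae_restrict_of_ae_restrict_of_subset Ioc_subset_Icc_self hz_pos] with τ hτ
  rw [ENNReal.toReal_ofReal hτ.le, smul_eq_mul, mul_comm]
end

section
/- Let M, A, B, L, D be natural numbers and K ≥ 0 a real number. Let p : [0,1] → ℝ^M be a continuous function satisfying ‖p(τ₂) − p(τ₁)‖ ≤ K ∫_{τ₁}^{τ₂} ‖p(σ)‖ dσ for all 0 ≤ τ₁ ≤ τ₂ ≤ 1. Let η ∈ ℝ, α ∈ ℝ^A, β ∈ ℝ^B, λ ∈ ℝ^L, δ ∈ ℝ^D, and suppose that every coordinate of λ and every coordinate of δ equals some coordinate of p(0) or some coordinate of p(1). Then the following two conditions are equivalent: (C₁) the tuple (η, p(τ), α, β, λ, δ) is nonzero for almost every τ ∈ [0,1]; (C₂) the tuple (η, p(τ), α, β) is nonzero for almost every τ ∈ [0,1]. -/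
open MeasureTheory Set

/-- Integral form of Grönwall's uniqueness: a nonnegative continuous function bounded by a multiple
of its own primitive from `a` vanishes. -/
theorem eq_zero_of_le_mul_integral_left {f : ℝ → ℝ} {K a b : ℝ}
    (hf : ContinuousOn f (Icc a b)) (hf0 : ∀ t ∈ Icc a b, 0 ≤ f t)
    (h : ∀ t ∈ Icc a b, f t ≤ K * ∫ s in a..t, f s) :
    ∀ t ∈ Icc a b, f t = 0 := by
  intro t ht
  have hab : a ≤ b := ht.1.trans ht.2
  have hint : IntegrableOn f (Icc a b) := hf.integrableOn_Icc
  have hF : ∀ x ∈ Icc a b, ∫ s in a..x, f s = 0 := by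
    refine eq_zero_of_abs_deriv_le_mul_abs_self_of_eq_zero_right (f' := f) (K := K) ?_ ?_ ?_ ?_
    · rw [← uIcc_of_le hab] at hint ⊢
      exact intervalIntegral.continuousOn_primitive_interval hint
    · intro x hx
      have hmem : Icc a b ∈ nhdsWithin x (Ioi x) :=
        Filter.mem_of_superset (Ioc_mem_nhdsGT hx.2) fun y hy => ⟨hx.1.trans hy.1.le, hy.2⟩
      have hcont : ContinuousWithinAt f (Ioi x) x :=
        (hf x ⟨hx.1, hx.2.le⟩).mono_of_mem_nhdsWithin hmem
      refine intervalIntegral.integral_hasDerivWithinAt_right (t := Ioi x) ?_ ?_ hcont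
      · exact (hf.mono (Icc_subset_Icc_right hx.2.le)).intervalIntegrable_of_Icc hx.1
      · exact ⟨Icc a b, hmem, hf.aestronglyMeasurable measurableSet_Icc⟩
    · exact intervalIntegral.integral_same
    · intro x hx
      have hx' : x ∈ Icc a b := ⟨hx.1, hx.2.le⟩
      have h0 : 0 ≤ ∫ s in a..x, f s :=
        intervalIntegral.integral_nonneg hx.1 fun u hu => hf0 u ⟨hu.1, hu.2.trans hx'.2⟩
      rw [Real.norm_of_nonneg (hf0 x hx'), Real.norm_of_nonneg h0]
      exact h x hx'
  refine le_antisymm ?_ (hf0 t ht)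
  simpa [hF t ht] using h t ht

/-- Backward-in-time version of `eq_zero_of_le_mul_integral_left`. -/
theorem eq_zero_of_le_mul_integral_right {f : ℝ → ℝ} {K a b : ℝ}
    (hf : ContinuousOn f (Icc a b)) (hf0 : ∀ t ∈ Icc a b, 0 ≤ f t)
    (h : ∀ t ∈ Icc a b, f t ≤ K * ∫ s in t..b, f s) :
    ∀ t ∈ Icc a b, f t = 0 := by
  have hmaps : MapsTo (fun t : ℝ => -t) (Icc (-b) (-a)) (Icc a b) :=
    fun t ht => ⟨by linarith [ht.2], by linarith [ht.1]⟩
  intro t ht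
  have key := eq_zero_of_le_mul_integral_left (f := fun t => f (-t)) (K := K) (a := -b) (b := -a)
    (hf.comp continuous_neg.continuousOn hmaps) (fun s hs => hf0 _ (hmaps hs))
    (fun s hs => by
      rw [intervalIntegral.integral_comp_neg, neg_neg]
      exact h _ (hmaps hs))
    (-t) ⟨neg_le_neg ht.2, neg_le_neg ht.1⟩
  simpa using key

/-- A continuous arc whose increments are bounded by a multiple of the integral of its norm, and
which vanishes at one point of `[a, b]`, vanishes on all of `[a, b]`. -/
theorem eq_zero_of_norm_sub_le_mul_integral {E : Type*} [NormedAddCommGroup E]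
    {p : ℝ → E} {K a b c : ℝ} (hp : ContinuousOn p (Icc a b))
    (h : ∀ s t : ℝ, a ≤ s → s ≤ t → t ≤ b → ‖p t - p s‖ ≤ K * ∫ σ in s..t, ‖p σ‖)
    (hc : c ∈ Icc a b) (hpc : p c = 0) : ∀ t ∈ Icc a b, p t = 0 := by
  intro t ht
  rw [← norm_eq_zero]
  rcases le_total t c with htc | hct
  · refine eq_zero_of_le_mul_integral_right (f := fun s => ‖p s‖) (K := K) (a := a) (b := c)
      (hp.mono (Icc_subset_Icc_right hc.2)).norm (fun _ _ => norm_nonneg _) (fun s hs => ?_)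
      t ⟨ht.1, htc⟩
    simpa [hpc] using h s c hs.1 hs.2 hc.2
  · refine eq_zero_of_le_mul_integral_left (f := fun s => ‖p s‖) (K := K) (a := c) (b := b)
      (hp.mono (Icc_subset_Icc_left hc.1)).norm (fun _ _ => norm_nonneg _) (fun s hs => ?_)
      t ⟨hct, ht.2⟩
    simpa [hpc] using h c s hc.1 hs.1 hs.2

/-- Reduction of the nontriviality condition (Lemma 3.3 of the paper): if the adjoint arc `p`
satisfies a Grönwall-type integral bound and every coordinate of the multipliers `λ` and `δ`
equals some coordinate of `p 0` or of `p 1`, then the nontriviality of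
`(η, p(τ), α, β, λ, δ)` a.e. is equivalent to that of `(η, p(τ), α, β)` a.e. -/
theorem nontriviality_reduction {M A B L D : ℕ} (K : ℝ) (hK : 0 ≤ K)
    (p : ℝ → Fin M → ℝ) (hp_cont : ContinuousOn p (Set.Icc (0 : ℝ) 1))
    (hp_gronwall : ∀ τ₁ τ₂ : ℝ, 0 ≤ τ₁ → τ₁ ≤ τ₂ → τ₂ ≤ 1 →
      ‖p τ₂ - p τ₁‖ ≤ K * ∫ σ in τ₁..τ₂, ‖p σ‖)
    (η : ℝ) (α : Fin A → ℝ) (β : Fin B → ℝ) (lam : Fin L → ℝ) (δ : Fin D → ℝ)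
    (hlam : ∀ i : Fin L, (∃ j : Fin M, lam i = p 0 j) ∨ (∃ j : Fin M, lam i = p 1 j))
    (hδ : ∀ i : Fin D, (∃ j : Fin M, δ i = p 0 j) ∨ (∃ j : Fin M, δ i = p 1 j)) :
    (∀ᵐ τ ∂(volume.restrict (Set.Icc (0 : ℝ) 1)),
        ¬(η = 0 ∧ p τ = 0 ∧ α = 0 ∧ β = 0 ∧ lam = 0 ∧ δ = 0)) ↔
    (∀ᵐ τ ∂(volume.restrict (Set.Icc (0 : ℝ) 1)),
        ¬(η = 0 ∧ p τ = 0 ∧ α = 0 ∧ β = 0)) := by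
  constructor
  · intro h
    filter_upwards [h, ae_restrict_mem measurableSet_Icc] with τ hτ hmem
    rintro ⟨hη, hpτ, hα, hβ⟩
    have hp := eq_zero_of_norm_sub_le_mul_integral hp_cont hp_gronwall hmem hpτ
    have hp0 : p 0 = 0 := hp 0 (by simp)
    have hp1 : p 1 = 0 := hp 1 (by simp)
    refine hτ ⟨hη, hpτ, hα, hβ, ?_, ?_⟩
    · ext i
      rcases hlam i with ⟨j, hj⟩ | ⟨j, hj⟩ <;> simp [hj, hp0, hp1]
    · ext i
      rcases hδ i with ⟨j, hj⟩ | ⟨j, hj⟩ <;> simp [hj, hp0, hp1]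
  · intro h
    filter_upwards [h] with τ hτ
    rintro ⟨hη, hpτ, hα, hβ, -, -⟩
    exact hτ ⟨hη, hpτ, hα, hβ⟩
end

section
/- Let V be a nonempty set, let ν ≥ 1 be a natural number, and let h₁, …, h_ν : V → ℝ. Suppose (v*, z*) ∈ V^ν × (0, ∞)^ν satisfies Σ_{k=1}^{ν} z*_k · h_k(v*_k) ≥ Σ_{k=1}^{ν} z_k · h_k(v_k) for every (v, z) ∈ V^ν × (0, ∞)^ν. Then for every k ∈ {1, …, ν}: h_k(v*_k) = 0 and h_k(v) ≤ 0 for all v ∈ V; in particular, v*_k maximizes h_k over V. -/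
/-- If `(v*, z*)` with all `z*_k > 0` maximizes `Σ_k z_k · h_k(v_k)` over all `v ∈ V^ν` and all
tuples `z` of strictly positive reals, then for every `k` the value `h_k(v*_k)` vanishes,
`h_k ≤ 0` on `V`, and in particular `v*_k` maximizes `h_k` over `V`. -/
theorem linear_in_z_maximization {V : Type*} [Nonempty V] {ν : ℕ} (hν : 1 ≤ ν)
    (h : Fin ν → V → ℝ) (vstar : Fin ν → V) (zstar : Fin ν → ℝ)
    (hzstar : ∀ k, 0 < zstar k)
    (hmax : ∀ (v : Fin ν → V) (z : Fin ν → ℝ), (∀ k, 0 < z k) →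
      ∑ k, z k * h k (v k) ≤ ∑ k, zstar k * h k (vstar k)) :
    ∀ k : Fin ν, h k (vstar k) = 0 ∧ (∀ v : V, h k v ≤ 0) ∧
      (∀ v : V, h k v ≤ h k (vstar k)) := by
  intro k
  have single : ∀ (v : V) (t : ℝ), 0 < t → t * h k v ≤ zstar k * h k (vstar k) := by
    intro v t ht
    have hle := hmax (Function.update vstar k v) (Function.update zstar k t) fun j => by
      rcases eq_or_ne j k with rfl | hj
      · simpa using ht
      · simpa [hj] using hzstar j
    rw [← Finset.add_sum_erase _ _ (Finset.mem_univ k),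
      ← Finset.add_sum_erase _ (fun j => zstar j * h j (vstar j)) (Finset.mem_univ k),
      Finset.sum_congr rfl fun j hj => by
        rw [Function.update_of_ne (Finset.ne_of_mem_erase hj),
          Function.update_of_ne (Finset.ne_of_mem_erase hj)]] at hle
    simpa only [Function.update_self, add_le_add_iff_right] using hle
  have hz := hzstar k
  have value_eq_zero : h k (vstar k) = 0 := by
    have double := single (vstar k) (2 * zstar k) (by linarith)
    have half := single (vstar k) (zstar k / 2) (by linarith)
    have product : zstar k * h k (vstar k) = 0 := by linarith
    exact (mul_eq_zero.mp product).resolve_left hz.ne'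
  have nonpos : ∀ v : V, h k v ≤ 0 := fun v => by
    simpa [value_eq_zero] using single v 1 one_pos
  exact ⟨value_eq_zero, nonpos, fun v => (nonpos v).trans_eq value_eq_zero.symm⟩
end

section
/- Let a < b be real numbers, let z : [0,1] → ℝ be Lebesgue integrable with z(τ) > 0 for almost every τ ∈ [0,1] and ∫₀¹ z(σ) dσ = b − a, and let ρ(τ) := a + ∫₀^τ z(σ) dσ, with inverse ρ⁻¹ : [a,b] → [0,1]. Let h : [0,1] → ℝ^d be Lebesgue measurable with σ ↦ z(σ)·h(σ) Lebesgue integrable, let Y₀ ∈ ℝ^d, and define Y(τ) := Y₀ + ∫₀^τ z(σ)·h(σ) dσ. Then the function s ↦ h(ρ⁻¹(s)) is Lebesgue integrable on [a,b], and for every t ∈ [a,b] one has Y(ρ⁻¹(t)) = Y₀ + ∫_a^t h(ρ⁻¹(s)) ds. -/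
open MeasureTheory Set

/-- The image of Lebesgue measure on `[a,b]` under the inverse of the primitive `ρ` of a
nonnegative density `z` on `[0,1]` is the measure with density `z`. -/
theorem map_inverse_primitive_eq_withDensity {a b : ℝ} {z ρ ρinv : ℝ → ℝ}
    (hz_int : IntegrableOn z (Icc (0 : ℝ) 1))
    (hz_nonneg : 0 ≤ᵐ[volume.restrict (Icc (0 : ℝ) 1)] z)
    (hρ : ∀ τ, ρ τ = a + ∫ σ in (0 : ℝ)..τ, z σ)
    (hρinv_maps : MapsTo ρinv (Icc a b) (Icc (0 : ℝ) 1))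
    (hle : ∀ s ∈ Icc a b, ∀ c ∈ Icc (0 : ℝ) 1, ρinv s ≤ c ↔ s ≤ ρ c)
    (hρ_le : ∀ c ∈ Icc (0 : ℝ) 1, ρ c ≤ b)
    (hmeas : AEMeasurable ρinv (volume.restrict (Icc a b))) :
    (volume.restrict (Icc a b)).map ρinv =
      (volume.restrict (Icc (0 : ℝ) 1)).withDensity fun σ => ENNReal.ofReal (z σ) := by
  have hIcc : ∀ c ∈ Icc (0 : ℝ) 1, (volume.restrict (Icc a b)).map ρinv (Iic c) =
      (volume.restrict (Icc (0 : ℝ) 1)).withDensity (fun σ => ENNReal.ofReal (z σ)) (Iic c) := by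
    intro c hc
    have hpre : ρinv ⁻¹' Iic c ∩ Icc a b = Icc a (ρ c) := by
      ext s
      constructor
      · rintro ⟨h1, h2⟩
        exact ⟨h2.1, (hle s h2 c hc).1 h1⟩
      · rintro ⟨h1, h2⟩
        have hs : s ∈ Icc a b := ⟨h1, h2.trans (hρ_le c hc)⟩
        exact ⟨(hle s hs c hc).2 h2, hs⟩
    have hcap : Iic c ∩ Icc (0 : ℝ) 1 = Icc 0 c := by
      ext s
      exact ⟨fun h => ⟨h.2.1, h.1⟩, fun h => ⟨h.2, h.1, h.2.trans hc.2⟩⟩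
    have hsub : Icc (0 : ℝ) c ⊆ Icc 0 1 := Icc_subset_Icc_right hc.2
    rw [Measure.map_apply_of_aemeasurable hmeas measurableSet_Iic,
      Measure.restrict_apply₀' measurableSet_Icc.nullMeasurableSet, hpre, Real.volume_Icc, hρ,
      add_sub_cancel_left, withDensity_apply _ measurableSet_Iic,
      Measure.restrict_restrict measurableSet_Iic, hcap,
      intervalIntegral.integral_of_le hc.1, ← integral_Icc_eq_integral_Ioc,
      ofReal_integral_eq_lintegral_ofReal (hz_int.mono_set hsub)
        (ae_restrict_of_ae_restrict_of_subset hsub hz_nonneg)]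
  refine Measure.ext_of_Iic _ _ fun c => ?_
  rcases lt_or_ge c 0 with hc | hc
  · have hpre : ρinv ⁻¹' Iic c ∩ Icc a b = ∅ := by
      ext s
      simp only [mem_inter_iff, mem_preimage, mem_Iic, mem_empty_iff_false, iff_false, not_and]
      intro h1 h2
      linarith [(hρinv_maps h2).1]
    have hcap : Iic c ∩ Icc (0 : ℝ) 1 = ∅ := by
      ext s
      simp only [mem_inter_iff, mem_Iic, mem_empty_iff_false, iff_false, not_and]
      intro h1 h2
      linarith [h2.1]
    rw [Measure.map_apply_of_aemeasurable hmeas measurableSet_Iic,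
      Measure.restrict_apply₀' measurableSet_Icc.nullMeasurableSet, hpre,
      withDensity_apply _ measurableSet_Iic, Measure.restrict_restrict measurableSet_Iic, hcap]
    simp
  rcases le_total c 1 with hc' | hc'
  · exact hIcc c ⟨hc, hc'⟩
  · have hpre : ρinv ⁻¹' Iic c ∩ Icc a b = ρinv ⁻¹' Iic 1 ∩ Icc a b := by
      ext s
      exact ⟨fun h => ⟨(hρinv_maps h.2).2, h.2⟩, fun h => ⟨(hρinv_maps h.2).2.trans hc', h.2⟩⟩
    have hcap : Iic c ∩ Icc (0 : ℝ) 1 = Iic 1 ∩ Icc (0 : ℝ) 1 := by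
      ext s
      exact ⟨fun h => ⟨h.2.2, h.2⟩, fun h => ⟨h.2.2.trans hc', h.2⟩⟩
    have h1 := hIcc 1 (by simp)
    rw [Measure.map_apply_of_aemeasurable hmeas measurableSet_Iic,
      Measure.restrict_apply₀' measurableSet_Icc.nullMeasurableSet,
      withDensity_apply _ measurableSet_Iic, Measure.restrict_restrict measurableSet_Iic] at h1 ⊢
    rw [hpre, hcap, h1]

/-- Backward change of variables along the time reparametrization: if
`Y(τ) = Y₀ + ∫₀^τ z(σ) • h(σ) dσ` with `z · h` integrable on `[0,1]`, then `s ↦ h(ρ⁻¹(s))`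
is integrable on `[a,b]` and `Y(ρ⁻¹(t)) = Y₀ + ∫_a^t h(ρ⁻¹(s)) ds` for every `t ∈ [a,b]`. -/
theorem time_scaling_inverse_change_of_variables {d : ℕ} (a b : ℝ) (hab : a < b)
    (z : ℝ → ℝ)
    (hz_int : IntegrableOn z (Set.Icc (0 : ℝ) 1))
    (hz_pos : ∀ᵐ τ ∂(volume.restrict (Set.Icc (0 : ℝ) 1)), 0 < z τ)
    (hz_sum : (∫ σ in (0 : ℝ)..1, z σ) = b - a)
    (ρ : ℝ → ℝ) (hρ : ∀ τ, ρ τ = a + ∫ σ in (0 : ℝ)..τ, z σ)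
    (ρinv : ℝ → ℝ)
    (hρinv : Set.InvOn ρinv ρ (Set.Icc (0 : ℝ) 1) (Set.Icc a b))
    (hρinv_maps : Set.MapsTo ρinv (Set.Icc a b) (Set.Icc (0 : ℝ) 1))
    (h : ℝ → Fin d → ℝ) (hh_meas : Measurable h)
    (hzh_int : IntegrableOn (fun σ => z σ • h σ) (Set.Icc (0 : ℝ) 1))
    (Y₀ : Fin d → ℝ) (Y : ℝ → Fin d → ℝ)
    (hY : ∀ τ, Y τ = Y₀ + ∫ σ in (0 : ℝ)..τ, z σ • h σ) :
    IntegrableOn (fun s => h (ρinv s)) (Set.Icc a b) ∧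
    (∀ t ∈ Set.Icc a b, Y (ρinv t) = Y₀ + ∫ s in a..t, h (ρinv s)) := by
  have hz_nonneg : 0 ≤ᵐ[volume.restrict (Icc (0 : ℝ) 1)] z := by
    filter_upwards [hz_pos] with τ hτ using hτ.le
  have hρ_zero : ρ 0 = a := by simp [hρ]
  have hρ_one : ρ 1 = b := by rw [hρ, hz_sum]; ring
  have hρ_mono : MonotoneOn ρ (Icc 0 1) := by
    intro x hx y hy hxy
    have hint : ∀ c ∈ Icc (0 : ℝ) 1, IntervalIntegrable z volume 0 c := fun c hc =>
      (intervalIntegrable_iff_integrableOn_Icc_of_le hc.1).2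
        (hz_int.mono_set (Icc_subset_Icc_right hc.2))
    have hsub := intervalIntegral.integral_interval_sub_left (hint y hy) (hint x hx)
    have hnn : 0 ≤ ∫ σ in x..y, z σ :=
      intervalIntegral.integral_nonneg_of_ae_restrict hxy
        (ae_restrict_of_ae_restrict_of_subset (Icc_subset_Icc hx.1 hy.2) hz_nonneg)
    rw [hρ, hρ]
    linarith
  have hρ_strict : StrictMonoOn ρ (Icc 0 1) := fun x hx y hy hxy =>
    (hρ_mono hx hy hxy.le).lt_of_ne fun heq => hxy.ne (hρinv.1.injOn hx hy heq)
  have hle : ∀ s ∈ Icc a b, ∀ c ∈ Icc (0 : ℝ) 1, ρinv s ≤ c ↔ s ≤ ρ c := by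
    intro s hs c hc
    rw [← hρ_strict.le_iff_le (hρinv_maps hs) hc, hρinv.2 hs]
  have hρ_le : ∀ c ∈ Icc (0 : ℝ) 1, ρ c ≤ b := fun c hc =>
    hρ_one ▸ hρ_mono hc (by simp) hc.2
  have hρinv_mono : MonotoneOn ρinv (Icc a b) := by
    intro s hs t ht hst
    rwa [hle s hs _ (hρinv_maps ht), hρinv.2 ht]
  have hmeas : AEMeasurable ρinv (volume.restrict (Icc a b)) :=
    aemeasurable_restrict_of_monotoneOn measurableSet_Icc hρinv_mono
  have hmap := map_inverse_primitive_eq_withDensity hz_int hz_nonneg hρ hρinv_maps hle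
    hρ_le hmeas
  have hz_meas : AEMeasurable (fun σ => ENNReal.ofReal (z σ)) (volume.restrict (Icc (0 : ℝ) 1)) :=
    hz_int.aemeasurable.ennreal_ofReal
  have hsmul : (fun σ => (ENNReal.ofReal (z σ)).toReal • h σ)
      =ᵐ[volume.restrict (Icc (0 : ℝ) 1)] fun σ => z σ • h σ := by
    filter_upwards [hz_nonneg] with σ hσ
    rw [ENNReal.toReal_ofReal hσ]
  refine ⟨?_, fun t ht => ?_⟩
  · refine (integrable_map_measure hh_meas.aestronglyMeasurable hmeas).1 ?_
    rw [hmap, integrable_withDensity_iff_integrable_smul₀' hz_meas (by simp)]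
    exact hzh_int.congr hsmul.symm
  · have hτ := hρinv_maps ht
    have hpre : ρinv ⁻¹' Iic (ρinv t) ∩ Icc a b = Icc a t := by
      ext s
      constructor
      · rintro ⟨h1, h2⟩
        have := (hle s h2 _ hτ).1 h1
        rw [hρinv.2 ht] at this
        exact ⟨h2.1, this⟩
      · rintro ⟨h1, h2⟩
        exact ⟨hρinv_mono ⟨h1, h2.trans ht.2⟩ ht h2, h1, h2.trans ht.2⟩
    have hcap : Iic (ρinv t) ∩ Icc (0 : ℝ) 1 = Icc 0 (ρinv t) := by
      ext s
      exact ⟨fun h => ⟨h.2.1, h.1⟩, fun h => ⟨h.2, h.1, h.2.trans hτ.2⟩⟩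
    have hnull : NullMeasurableSet (ρinv ⁻¹' Iic (ρinv t)) (volume.restrict (Icc a b)) :=
      hmeas.nullMeasurableSet_preimage measurableSet_Iic
    have hset := setIntegral_map (measurableSet_Iic (a := ρinv t))
      hh_meas.aestronglyMeasurable hmeas
    rw [hmap, Measure.restrict_restrict₀ hnull, hpre,
      restrict_withDensity measurableSet_Iic, Measure.restrict_restrict measurableSet_Iic, hcap,
      integral_withDensity_eq_integral_toReal_smul₀
        (hz_meas.mono_measure (Measure.restrict_mono (Icc_subset_Icc_right hτ.2) le_rfl))
        (by simp),
      integral_congr_ae (ae_restrict_of_ae_restrict_of_subset (Icc_subset_Icc_right hτ.2) hsmul),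
      integral_Icc_eq_integral_Ioc, integral_Icc_eq_integral_Ioc] at hset
    rw [hY, intervalIntegral.integral_of_le hτ.1, intervalIntegral.integral_of_le ht.1, hset]
end
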